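/- Let p ≥ 0 be an integer, let G be a graph, and let G^{(p)} denote its p-subdivision. Then χ(G)^{1/(p+1)} ≤ χ_{p+1}(G^{(p)}) ≤ max(χ(G), p+2); equivalently, χ(G) ≤ χ_{p+1}(G^{(p)})^{p+1} and χ_{p+1}(G^{(p)}) ≤ max(χ(G), p+2). -/

import Mathlib

open SimpleGraph

/-! ## Basic containment relations between graphs -/

/-- `H` is isomorphic to a (not necessarily induced) subgraph of `G`. -/
def IsSubgraphOf {V W : Type*} (H : SimpleGraph V) (G : SimpleGraph W) : Prop :=
  ∃ f : H →g G, Function.Injective f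

/-- `H` is isomorphic to an induced subgraph of `G`. -/
def IsInducedSubgraphOf {V W : Type*} (H : SimpleGraph V) (G : SimpleGraph W) : Prop :=
  Nonempty (H ↪g G)

/-- The clique number `ω(G)`: the largest `m` such that `K_m` is a subgraph of `G`. -/
noncomputable def omegaNum {V : Type*} (G : SimpleGraph V) : ℕ :=
  sSup {m | IsSubgraphOf (⊤ : SimpleGraph (Fin m)) G}

/-- The chromatic number `χ(G)` (as a natural number). -/
noncomputable def chi {V : Type*} (G : SimpleGraph V) : ℕ :=
  sInf {N | G.Colorable N}

/-! ## Tree-depth and the invariants `χ_p` -/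

/-- A forest order: a partial order in which the down-set of every element is a chain.
Such orders are exactly the ancestor orders of rooted forests. -/
def IsForestOrder {V : Type*} (r : V → V → Prop) : Prop :=
  (∀ v, r v v) ∧ (∀ u v, r u v → r v u → u = v) ∧
  (∀ u v w, r u v → r v w → r u w) ∧
  (∀ u v w, r u w → r v w → r u v ∨ r v u)

/-- `G` has tree-depth at most `h`: `G` is a subgraph of the closure of a rooted forest
of height at most `h` (height = maximum number of vertices on a root-to-leaf path). -/
def TreeDepthLE {V : Type*} (G : SimpleGraph V) (h : ℕ) : Prop :=
  ∃ r : V → V → Prop, IsForestOrder r ∧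
    (∀ u v, G.Adj u v → r u v ∨ r v u) ∧
    (∀ v, {u | r u v}.ncard ≤ h)

/-- The tree-depth `td(G)`. -/
noncomputable def treeDepth {V : Type*} (G : SimpleGraph V) : ℕ :=
  sInf {h | TreeDepthLE G h}

/-- `χ_p(G)`: the least number of colors of a vertex coloring such that every set `I` of at
most `p` colors induces a subgraph of tree-depth at most `|I|`. -/
noncomputable def chiP {V : Type*} (G : SimpleGraph V) (p : ℕ) : ℕ :=
  sInf {N | ∃ c : V → Fin N, ∀ I : Finset (Fin N), I.card ≤ p →
    TreeDepthLE (G.induce {v | c v ∈ I}) I.card}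

/-! ## Star colorings -/

/-- A star coloring: a proper coloring with no path on `4` vertices using only two colors. -/
def IsStarColoring {V α : Type*} (G : SimpleGraph V) (c : V → α) : Prop :=
  (∀ u v, G.Adj u v → c u ≠ c v) ∧
  ∀ x y z w : V, G.Adj x y → G.Adj y z → G.Adj z w →
    x ≠ z → y ≠ w → x ≠ w → ¬(c x = c z ∧ c y = c w)

/-- The star chromatic number `χ_s(G)`. -/
noncomputable def starChi {V : Type*} (G : SimpleGraph V) : ℕ :=
  sInf {N | ∃ c : V → Fin N, IsStarColoring G c}

/-! ## Subdivisions -/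

/-- The edges of a graph on `Fin n`, presented as increasingly ordered pairs. -/
def Edges {n : ℕ} (H : SimpleGraph (Fin n)) : Type :=
  {p : Fin n × Fin n // p.1 < p.2 ∧ H.Adj p.1 p.2}

/-- Base relation of the subdivision of `H`, where the edge `e` receives `t e` internal
vertices. -/
def subdivRel {n : ℕ} (H : SimpleGraph (Fin n)) (t : Edges H → ℕ) :
    (Fin n ⊕ Σ e : Edges H, Fin (t e)) → (Fin n ⊕ Σ e : Edges H, Fin (t e)) → Prop
  | Sum.inl u, Sum.inl v => ∃ h : u < v ∧ H.Adj u v, t ⟨(u, v), h⟩ = 0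
  | Sum.inl u, Sum.inr ⟨e, i⟩ =>
      (u = e.1.1 ∧ (i : ℕ) = 0) ∨ (u = e.1.2 ∧ (i : ℕ) + 1 = t e)
  | Sum.inr ⟨e, i⟩, Sum.inr ⟨e', j⟩ => e = e' ∧ (i : ℕ) + 1 = (j : ℕ)
  | _, _ => False

/-- The subdivision of `H` in which each edge `e` is replaced by a path with exactly `t e`
internal vertices. In particular `Subdiv H (fun _ => r)` is the `r`-subdivision `H^{(r)}`,
and the `(≤ r)`-subdivisions of `H` are the graphs `Subdiv H t` with `t e ≤ r` for all `e`. -/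
def Subdiv {n : ℕ} (H : SimpleGraph (Fin n)) (t : Edges H → ℕ) :
    SimpleGraph (Fin n ⊕ Σ e : Edges H, Fin (t e)) :=
  SimpleGraph.fromRel (subdivRel H t)

/-- `H ∈ TM_r(G)`: some `(≤ r)`-subdivision of `H` is a subgraph of `G`. -/
def MemTM {W : Type*} (r : ℕ) (G : SimpleGraph W) {n : ℕ} (H : SimpleGraph (Fin n)) : Prop :=
  ∃ t : Edges H → ℕ, (∀ e, t e ≤ r) ∧ IsSubgraphOf (Subdiv H t) G

/-- `H ∈ ITM_r^e(G)`: the exact `r`-subdivision of `H` is an induced subgraph of `G`. -/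
def MemITM {W : Type*} (r : ℕ) (G : SimpleGraph W) {n : ℕ} (H : SimpleGraph (Fin n)) : Prop :=
  IsInducedSubgraphOf (Subdiv H (fun _ => r)) G

/-- `ω(TM_r(G))`: the supremum of the clique numbers of the graphs in `TM_r(G)`. -/
noncomputable def omegaTM {W : Type*} (r : ℕ) (G : SimpleGraph W) : ℕ :=
  sSup {m | ∃ (k : ℕ) (H : SimpleGraph (Fin k)), MemTM r G H ∧ omegaNum H = m}

/-- The biclique number `bω(G)`: the largest `s` with `K_{s,s}` a subgraph of `G`. -/
noncomputable def bomega {V : Type*} (G : SimpleGraph V) : ℕ :=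
  sSup {s | IsSubgraphOf (completeBipartiteGraph (Fin s) (Fin s)) G}

/-- The average degree `d̄(G) = 2|E(G)|/|V(G)|`. -/
noncomputable def avgDeg {n : ℕ} (G : SimpleGraph (Fin n)) : ℝ :=
  2 * (G.edgeSet.ncard : ℝ) / n

/-! ## Classes of graphs -/

/-- A class of (finite, simple) graphs: for each `n`, a set of graphs on `Fin n`.
Classes are implicitly closed under isomorphism via the relations used below. -/
def GraphClass := ∀ n : ℕ, Set (SimpleGraph (Fin n))

/-- A hereditary class: closed under induced subgraphs (hence under isomorphism). -/
def Hereditary (C : GraphClass) : Prop :=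
  ∀ ⦃n m : ℕ⦄ (G : SimpleGraph (Fin n)) (H : SimpleGraph (Fin m)),
    G ∈ C n → IsInducedSubgraphOf H G → H ∈ C m

/-- A monotone class: closed under subgraphs (hence under isomorphism). -/
def MonotoneClass (C : GraphClass) : Prop :=
  ∀ ⦃n m : ℕ⦄ (G : SimpleGraph (Fin n)) (H : SimpleGraph (Fin m)),
    G ∈ C n → IsSubgraphOf H G → H ∈ C m

/-- `H ∈ TM_r(𝒞)`. -/
def MemTMClass (r : ℕ) (C : GraphClass) {m : ℕ} (H : SimpleGraph (Fin m)) : Prop :=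
  ∃ (n : ℕ) (G : SimpleGraph (Fin n)), G ∈ C n ∧ MemTM r G H

/-- `H ∈ ITM_r^e(𝒞)`. -/
def MemITMClass (r : ℕ) (C : GraphClass) {m : ℕ} (H : SimpleGraph (Fin m)) : Prop :=
  ∃ (n : ℕ) (G : SimpleGraph (Fin n)), G ∈ C n ∧ MemITM r G H

/-- `𝒞` is `χ`-bounded: `χ(H) ≤ f(ω(H))` for every induced subgraph `H` of a graph of `𝒞`. -/
def ChiBounded (C : GraphClass) : Prop :=
  ∃ f : ℕ → ℕ, ∀ ⦃n : ℕ⦄ (G : SimpleGraph (Fin n)), G ∈ C n →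
    ∀ ⦃m : ℕ⦄ (H : SimpleGraph (Fin m)), IsInducedSubgraphOf H G →
      chi H ≤ f (omegaNum H)

/-- `𝒞` has bounded expansion: for every `r`, `d̄(TM_r(𝒞)) < ∞`. -/
def BoundedExpansion (C : GraphClass) : Prop :=
  ∀ r : ℕ, ∃ d : ℝ, ∀ ⦃m : ℕ⦄ (H : SimpleGraph (Fin m)), MemTMClass r C H → avgDeg H ≤ d

/-- `𝒞` has `ω`-bounded expansion. -/
def OmegaBoundedExpansion (C : GraphClass) : Prop :=
  ∃ f : ℕ → ℕ → ℝ, ∀ ⦃n : ℕ⦄ (G : SimpleGraph (Fin n)), G ∈ C n →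
    ∀ (r : ℕ) ⦃m : ℕ⦄ (H : SimpleGraph (Fin m)), MemTM r G H →
      avgDeg H ≤ f (omegaNum G) r

/-- `𝒞` is nowhere dense: for every `r`, `ω(TM_r(𝒞)) < ∞`. -/
def NowhereDense (C : GraphClass) : Prop :=
  ∀ r : ℕ, ∃ c : ℕ, ∀ ⦃m : ℕ⦄ (H : SimpleGraph (Fin m)), MemTMClass r C H → omegaNum H ≤ c

/-- `𝒞` is strongly `χ_p`-bounded: `χ_p(G) ≤ f_p(ω(G))` on `𝒞`. -/
def StronglyChiPBounded (C : GraphClass) (p : ℕ) : Prop :=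
  ∃ f : ℕ → ℕ, ∀ ⦃n : ℕ⦄ (G : SimpleGraph (Fin n)), G ∈ C n → chiP G p ≤ f (omegaNum G)

/-- `𝒞` is weakly `χ_p`-bounded: `χ_p(G) ≤ g_p(ω(TM_{p-1}(G)))` on `𝒞`. -/
def WeaklyChiPBounded (C : GraphClass) (p : ℕ) : Prop :=
  ∃ g : ℕ → ℕ, ∀ ⦃n : ℕ⦄ (G : SimpleGraph (Fin n)), G ∈ C n → chiP G p ≤ g (omegaTM (p - 1) G)

/-! ## Directed graphs, orientations and restricted dualities -/

/-- Existence of a homomorphism between directed graphs presented as binary relations. -/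
def DigraphHomEx {n m : ℕ} (A : Fin n → Fin n → Prop) (B : Fin m → Fin m → Prop) : Prop :=
  ∃ f : Fin n → Fin m, ∀ u v, A u v → B (f u) (f v)

/-- `A` is an orientation of the graph `G`. -/
def IsOrientationOf {n : ℕ} (A : Fin n → Fin n → Prop) (G : SimpleGraph (Fin n)) : Prop :=
  (∀ u v, ¬(A u v ∧ A v u)) ∧ (∀ u v, G.Adj u v ↔ (A u v ∨ A v u))

/-- A directed graph is acyclic if it has no directed cycle. -/
def IsAcyclicDigraph {n : ℕ} (A : Fin n → Fin n → Prop) : Prop :=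
  ∀ v, ¬ Relation.TransGen A v v

/-- The directed graph `F` has a restricted dual for the class of all orientations of the
graphs of `𝒞`. -/
def HasRestrictedDualForOrientations (C : GraphClass) {nF : ℕ}
    (F : Fin nF → Fin nF → Prop) : Prop :=
  ∃ (m : ℕ) (D : Fin m → Fin m → Prop),
    ¬ DigraphHomEx F D ∧
    ∀ ⦃n : ℕ⦄ (A : Fin n → Fin n → Prop) (G : SimpleGraph (Fin n)),
      G ∈ C n → IsOrientationOf A G →
      (¬ DigraphHomEx F A ↔ DigraphHomEx A D)

/-! ## Holes -/

/-- The number `h_g(G)` of holes of length `g` in `G`, i.e. of vertex subsets inducing a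
cycle on `g` vertices. -/
noncomputable def holeCount {n : ℕ} (g : ℕ) (G : SimpleGraph (Fin n)) : ℕ :=
  {S : Set (Fin n) | Nonempty (G.induce S ≃g SimpleGraph.cycleGraph g)}.ncard

/-- `G` is even hole-free: it has no induced cycle of even length at least `4`. -/
def EvenHoleFree {n : ℕ} (G : SimpleGraph (Fin n)) : Prop :=
  ∀ g : ℕ, 4 ≤ g → Even g → holeCount g G = 0

lemma treeDepthLE_of_parent {V : Type*} (G : SimpleGraph V) (h : ℕ) (par : V → V) (rank : V → ℕ)
    (hrank : ∀ v, par v = v ∨ rank (par v) < rank v)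
    (hadj : ∀ u v, G.Adj u v → par u = v ∨ par v = u)
    (hheight : ∀ v, {u | ∃ k, par^[k] v = u}.ncard ≤ h) : TreeDepthLE G h := by
  have hiter : ∀ k v, par^[k] v = v ∨ rank (par^[k] v) < rank v := by
    intro k
    induction k with
    | zero => intro v; exact Or.inl rfl
    | succ k ih =>
      intro v
      rw [Function.iterate_succ_apply]
      rcases hrank v with hv | hv
      · rw [hv]; exact ih v
      · rcases ih (par v) with h' | h'
        · rw [h']; exact Or.inr hv
        · exact Or.inr (h'.trans hv)
  refine ⟨fun u v => ∃ k, par^[k] v = u, ⟨fun v => ⟨0, rfl⟩, ?_, ?_, ?_⟩, ?_, hheight⟩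
  · rintro u v ⟨k, hk⟩ ⟨l, hl⟩
    rcases hiter k v with h1 | h1
    · exact hk.symm.trans h1
    · rcases hiter l u with h2 | h2
      · exact h2.symm.trans hl
      · rw [hk] at h1; rw [hl] at h2; omega
  · rintro u v w ⟨k, rfl⟩ ⟨l, rfl⟩
    exact ⟨k + l, Function.iterate_add_apply par k l w⟩
  · rintro u v w ⟨k, rfl⟩ ⟨l, rfl⟩
    rcases le_total k l with hkl | hkl
    · right
      refine ⟨l - k, ?_⟩
      rw [← Function.iterate_add_apply, Nat.sub_add_cancel hkl]
    · left
      refine ⟨k - l, ?_⟩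
      rw [← Function.iterate_add_apply, Nat.sub_add_cancel hkl]
  · intro u v huv
    rcases hadj u v huv with h' | h'
    · exact Or.inr ⟨1, h'⟩
    · exact Or.inl ⟨1, h'⟩

instance {n : ℕ} (H : SimpleGraph (Fin n)) : Finite (Edges H) :=
  inferInstanceAs (Finite {p : Fin n × Fin n // p.1 < p.2 ∧ H.Adj p.1 p.2})

/-- The `i`-th vertex on the path replacing the edge `e` in the `p`-subdivision. -/
def subdivPath {n : ℕ} {G : SimpleGraph (Fin n)} {p : ℕ} (e : Edges G) :
    ℕ → Fin n ⊕ Σ _ : Edges G, Fin p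
  | 0 => Sum.inl e.1.1
  | i + 1 => if h : i < p then Sum.inr ⟨e, ⟨i, h⟩⟩ else Sum.inl e.1.2

section Path

variable {n : ℕ} {G : SimpleGraph (Fin n)} {p : ℕ}

@[simp] lemma subdivPath_zero (e : Edges G) :
    (subdivPath e 0 : Fin n ⊕ Σ _ : Edges G, Fin p) = Sum.inl e.1.1 := rfl

lemma subdivPath_succ_of_lt (e : Edges G) {i : ℕ} (h : i < p) :
    (subdivPath e (i + 1) : Fin n ⊕ Σ _ : Edges G, Fin p) = Sum.inr ⟨e, ⟨i, h⟩⟩ := by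
  simp [subdivPath, h]

@[simp] lemma subdivPath_last (e : Edges G) :
    (subdivPath e (p + 1) : Fin n ⊕ Σ _ : Edges G, Fin p) = Sum.inl e.1.2 := by
  simp [subdivPath]

lemma subdivPath_cases (e : Edges G) {i : ℕ} (hi : i ≤ p + 1) :
    i = 0 ∨ i = p + 1 ∨ ∃ j : Fin p, i = j + 1 ∧
      (subdivPath e i : Fin n ⊕ Σ _ : Edges G, Fin p) = Sum.inr ⟨e, j⟩ := by
  rcases i with _ | i
  · exact Or.inl rfl
  · by_cases h : i < p
    · exact Or.inr (Or.inr ⟨⟨i, h⟩, rfl, subdivPath_succ_of_lt e h⟩)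
    · right; left; omega

lemma subdivPath_injOn (e : Edges G) {i j : ℕ} (hi : i ≤ p + 1) (hj : j ≤ p + 1)
    (h : (subdivPath e i : Fin n ⊕ Σ _ : Edges G, Fin p) = subdivPath e j) : i = j := by
  have hne : e.1.1 ≠ e.1.2 := e.2.1.ne
  rcases subdivPath_cases (p := p) e hi with rfl | rfl | ⟨a, rfl, ha⟩ <;>
  rcases subdivPath_cases (p := p) e hj with rfl | rfl | ⟨b, rfl, hb⟩
  · rfl
  · simp [hne] at h
  · rw [hb] at h; simp at h
  · simp [hne.symm] at h
  · rfl
  · rw [hb] at h; simp at h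
  · rw [ha] at h; simp at h
  · rw [ha] at h; simp at h
  · rw [ha, hb] at h
    simp only [Sum.inr.injEq, Sigma.mk.injEq, heq_eq_eq, true_and] at h
    rw [h]

lemma subdivPath_rel (e : Edges G) {i : ℕ} (hi : i ≤ p) :
    subdivRel G (fun _ => p) (subdivPath e i) (subdivPath e (i + 1)) ∨
    subdivRel G (fun _ => p) (subdivPath e (i + 1)) (subdivPath e i) := by
  rcases i with _ | i
  · by_cases hp : 0 < p
    · left; rw [subdivPath_succ_of_lt e hp]; exact Or.inl ⟨rfl, rfl⟩
    · obtain rfl : p = 0 := by omega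
      left; rw [subdivPath_last]; exact ⟨e.2, rfl⟩
  · rw [subdivPath_succ_of_lt e (by omega : i < p)]
    by_cases hp : i + 1 < p
    · left; rw [subdivPath_succ_of_lt e hp]; exact ⟨rfl, rfl⟩
    · obtain rfl : p = i + 1 := by omega
      right; rw [subdivPath_last]; exact Or.inr ⟨rfl, rfl⟩

lemma subdivPath_adj (e : Edges G) {i : ℕ} (hi : i ≤ p) :
    (Subdiv G (fun _ => p)).Adj (subdivPath e i) (subdivPath e (i + 1)) := by
  refine (SimpleGraph.fromRel_adj _ _ _).2 ⟨fun h => ?_, subdivPath_rel e hi⟩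
  have := subdivPath_injOn e (by omega) (by omega) h
  omega

lemma exists_subdivPath_of_rel {x y : Fin n ⊕ Σ _ : Edges G, Fin p}
    (h : subdivRel G (fun _ => p) x y) :
    ∃ (e : Edges G) (i : ℕ), i ≤ p ∧
      ((x = subdivPath e i ∧ y = subdivPath e (i + 1)) ∨
        (y = subdivPath e i ∧ x = subdivPath e (i + 1))) := by
  rcases x with u | ⟨e, i⟩ <;> rcases y with v | ⟨e', j⟩
  · obtain ⟨h, hp⟩ := h
    obtain rfl : p = 0 := hp
    exact ⟨⟨(u, v), h⟩, 0, le_rfl, Or.inl ⟨rfl, (subdivPath_last (G := G) (p := 0) ⟨(u, v), h⟩).symm⟩⟩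
  · rcases h with ⟨rfl, hj⟩ | ⟨rfl, hj⟩
    · refine ⟨e', 0, by omega, Or.inl ⟨rfl, ?_⟩⟩
      rw [subdivPath_succ_of_lt e' (hj ▸ j.2 : 0 < p)]
      congr 2; exact Fin.ext hj
    · refine ⟨e', j + 1, j.2, Or.inr ⟨?_, ?_⟩⟩
      · rw [subdivPath_succ_of_lt e' j.2]
      · have hj' : (j : ℕ) + 1 = p := hj
        rw [hj', subdivPath_last]
  · exact h.elim
  · obtain ⟨rfl, hj⟩ := h
    refine ⟨e, i + 1, i.2, Or.inl ⟨?_, ?_⟩⟩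
    · rw [subdivPath_succ_of_lt e i.2]
    · rw [subdivPath_succ_of_lt e (hj ▸ j.2 : (i : ℕ) + 1 < p)]
      congr 2; exact Fin.ext hj.symm

lemma exists_subdivPath_of_adj {x y : Fin n ⊕ Σ _ : Edges G, Fin p}
    (h : (Subdiv G (fun _ => p)).Adj x y) :
    ∃ (e : Edges G) (i : ℕ), i ≤ p ∧
      ((x = subdivPath e i ∧ y = subdivPath e (i + 1)) ∨
        (y = subdivPath e i ∧ x = subdivPath e (i + 1))) := by
  rcases ((SimpleGraph.fromRel_adj _ _ _).1 h).2 with h | h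
  · exact exists_subdivPath_of_rel h
  · obtain ⟨e, i, hi, h⟩ := exists_subdivPath_of_rel h
    exact ⟨e, i, hi, h.symm⟩

open Classical in
/-- The parent of a vertex in an elimination forest of the subgraph of the `p`-subdivision induced
by `S`, where `S` contains no full subdivided edge: an internal vertex joined inside `S` to the
first end of its edge has its predecessor as parent; otherwise its parent is its successor, if that
lies in `S`. -/
noncomputable def subdivParent (S : Set (Fin n ⊕ Σ _ : Edges G, Fin p)) :
    (Fin n ⊕ Σ _ : Edges G, Fin p) → (Fin n ⊕ Σ _ : Edges G, Fin p)
  | Sum.inl v => Sum.inl v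
  | Sum.inr ⟨e, i⟩ =>
      if ∀ k ≤ (i : ℕ) + 1, subdivPath e k ∈ S then subdivPath e i
      else if subdivPath e (i + 2) ∈ S then subdivPath e (i + 2) else Sum.inr ⟨e, i⟩

open Classical in
/-- The depth of a vertex in the forest of `subdivParent`, up to a shift on each component. -/
noncomputable def subdivRank (S : Set (Fin n ⊕ Σ _ : Edges G, Fin p)) :
    (Fin n ⊕ Σ _ : Edges G, Fin p) → ℕ
  | Sum.inl _ => 0
  | Sum.inr ⟨e, i⟩ => if ∀ k ≤ (i : ℕ) + 1, subdivPath e k ∈ S then i + 1 else p - i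

lemma subdivParent_mem {S : Set (Fin n ⊕ Σ _ : Edges G, Fin p)} {x} (hx : x ∈ S) :
    subdivParent S x ∈ S := by
  rcases x with v | ⟨e, i⟩
  · exact hx
  · simp only [subdivParent]
    split_ifs with h1 h2
    · exact h1 _ (by omega)
    · exact h2
    · exact hx

lemma subdivParent_path (S : Set (Fin n ⊕ Σ _ : Edges G, Fin p)) (e : Edges G) {i : ℕ}
    (hi : i ≤ p + 1) : ∃ j ≤ p + 1, subdivParent S (subdivPath e i) = subdivPath e j := by
  rcases subdivPath_cases (p := p) e hi with rfl | rfl | ⟨a, rfl, ha⟩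
  · exact ⟨0, hi, rfl⟩
  · exact ⟨p + 1, hi, by rw [subdivPath_last]; rfl⟩
  · have := a.2
    rw [ha]
    simp only [subdivParent]
    split_ifs with h1 h2
    · exact ⟨a, by omega, rfl⟩
    · exact ⟨a + 2, by omega, rfl⟩
    · exact ⟨a + 1, hi, ha.symm⟩

lemma subdivParent_rank (S : Set (Fin n ⊕ Σ _ : Edges G, Fin p)) (x) :
    subdivParent S x = x ∨ subdivRank S (subdivParent S x) < subdivRank S x := by
  rcases x with v | ⟨e, ⟨i, hi⟩⟩
  · exact Or.inl rfl
  · simp only [subdivParent]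
    split_ifs with h1 h2
    · right
      rcases i with _ | i
      · simp only [subdivRank, subdivPath_zero]
        rw [if_pos h1]
        omega
      · rw [subdivPath_succ_of_lt e (by omega)]
        have h3 : ∀ k ≤ i + 1, subdivPath e k ∈ S := fun k hk => h1 k (by omega)
        simp only [subdivRank]
        rw [if_pos h1, if_pos h3]
        omega
    · right
      by_cases hip : i + 1 < p
      · rw [subdivPath_succ_of_lt e hip]
        have h3 : ¬ ∀ k ≤ i + 1 + 1, subdivPath e k ∈ S :=
          fun h => h1 fun k hk => h k (by omega)
        simp only [subdivRank]
        rw [if_neg h1, if_neg h3]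
        omega
      · obtain rfl : p = i + 1 := by omega
        rw [subdivPath_last]
        simp only [subdivRank]
        rw [if_neg h1]
        omega
    · exact Or.inl rfl

lemma subdivParent_adj {S : Set (Fin n ⊕ Σ _ : Edges G, Fin p)} (e : Edges G)
    (hgap : ∃ k ≤ p + 1, subdivPath e k ∉ S) {i : ℕ} (hi : i ≤ p)
    (h0 : subdivPath e i ∈ S) (h1 : subdivPath e (i + 1) ∈ S) :
    subdivParent S (subdivPath e i) = subdivPath e (i + 1) ∨
      subdivParent S (subdivPath e (i + 1)) = subdivPath e i := by
  by_cases hl : ∀ k ≤ i + 1, subdivPath e k ∈ S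
  · right
    have hip : i < p := by
      by_contra h
      obtain rfl : p = i := by omega
      obtain ⟨k, hk, hkS⟩ := hgap
      exact hkS (hl k hk)
    rw [subdivPath_succ_of_lt e hip]
    simp only [subdivParent]
    rw [if_pos hl]
  · left
    have hl' : ¬ ∀ k ≤ i, subdivPath e k ∈ S := by
      intro h
      apply hl
      intro k hk
      rcases Nat.le_succ_iff.1 hk with h' | rfl
      · exact h k h'
      · exact h1
    rcases i with _ | i
    · exact absurd (fun k hk => by obtain rfl : k = 0 := by omega
                                   exact h0) hl'
    · rw [subdivPath_succ_of_lt e (by omega : i < p)]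
      simp only [subdivParent]
      rw [if_neg hl', if_pos h1]

lemma treeDepthLE_induce_subdiv {N : ℕ} (c : (Fin n ⊕ Σ _ : Edges G, Fin p) → Fin N)
    (hc : ∀ e : Edges G, ∀ i ≤ p + 1, ∀ j ≤ p + 1,
      c (subdivPath e i) = c (subdivPath e j) → i = j)
    (I : Finset (Fin N)) (hI : I.card ≤ p + 1) :
    TreeDepthLE ((Subdiv G (fun _ => p)).induce {v | c v ∈ I}) I.card := by
  have hgap : ∀ e : Edges G, ∃ k ≤ p + 1, subdivPath e k ∉ {v | c v ∈ I} := by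
    intro e
    by_contra! h
    have : (Finset.range (p + 2)).card ≤ I.card := by
      refine Finset.card_le_card_of_injOn (fun k => c (subdivPath e k)) ?_ ?_
      · intro k hk
        exact h k (by simp at hk; omega)
      · intro a ha b hb hab
        simp only [Finset.coe_range, Set.mem_Iio] at ha hb
        exact hc e a (by omega) b (by omega) hab
    simp at this
    omega
  generalize hS : {v | c v ∈ I} = S at hgap
  have hSI : ∀ x ∈ S, c x ∈ I := by rw [← hS]; exact fun x hx => hx
  have hiter : ∀ (k : ℕ) (x : S),
      ((fun y : S => (⟨subdivParent S y, subdivParent_mem y.2⟩ : S))^[k] x : _)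
        = (subdivParent S)^[k] x.1 := by
    intro k x
    induction k generalizing x with
    | zero => rfl
    | succ k ih => rw [Function.iterate_succ_apply, Function.iterate_succ_apply, ih]
  refine treeDepthLE_of_parent _ _ (fun y => ⟨subdivParent S y, subdivParent_mem y.2⟩)
    (fun y => subdivRank S y) ?_ ?_ ?_
  · intro v
    exact (subdivParent_rank S v.1).imp (fun h => Subtype.ext h) id
  · rintro ⟨u, hu⟩ ⟨v, hv⟩ huv
    simp only [Subtype.mk.injEq]
    obtain ⟨e, i, hi, ⟨rfl, rfl⟩ | ⟨rfl, rfl⟩⟩ := exists_subdivPath_of_adj huv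
    · exact subdivParent_adj e (hgap e) hi hu hv
    · exact (subdivParent_adj e (hgap e) hi hv hu).symm
  · intro v
    have key : Set.InjOn (fun u : S => c u.1) {u | ∃ k,
        (fun y : S => (⟨subdivParent S y, subdivParent_mem y.2⟩ : S))^[k] v = u} := by
      obtain ⟨v, hv⟩ := v
      rcases v with w | ⟨e, i⟩
      · have h1 : ∀ k, (subdivParent S)^[k] (Sum.inl w) = Sum.inl w :=
          fun k => Function.iterate_fixed rfl k
        rintro _ ⟨k, rfl⟩ _ ⟨l, rfl⟩ _
        apply Subtype.ext
        rw [hiter, hiter, h1, h1]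
      · have h1 : ∀ k, ∃ j ≤ p + 1, (subdivParent S)^[k] (Sum.inr ⟨e, i⟩) = subdivPath e j := by
          intro k
          induction k with
          | zero => exact ⟨i + 1, by omega, (subdivPath_succ_of_lt e i.2).symm⟩
          | succ k ih =>
            obtain ⟨j, hj, h⟩ := ih
            rw [Function.iterate_succ_apply', h]
            exact subdivParent_path S e hj
        rintro _ ⟨k, rfl⟩ _ ⟨l, rfl⟩ h
        apply Subtype.ext
        simp only [hiter] at h ⊢
        obtain ⟨a, ha, ha'⟩ := h1 k
        obtain ⟨b, hb, hb'⟩ := h1 l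
        rw [ha', hb'] at h ⊢
        rw [hc e a ha b hb h]
    rw [← Set.ncard_coe_finset I]
    exact Set.ncard_le_ncard_of_injOn _ (fun u _ => hSI _ u.2) key I.finite_toSet

lemma exists_subdiv_coloring {N : ℕ} (hN : p + 2 ≤ N) (f : G.Coloring (Fin N)) :
    ∃ c : (Fin n ⊕ Σ _ : Edges G, Fin p) → Fin N, ∀ e : Edges G, ∀ i ≤ p + 1, ∀ j ≤ p + 1,
      c (subdivPath e i) = c (subdivPath e j) → i = j := by
  have hg : ∀ e : Edges G, ∃ g : Fin p → Fin N, Function.Injective g ∧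
      ∀ i, g i ≠ f e.1.1 ∧ g i ≠ f e.1.2 := by
    intro e
    have hcard : p ≤ (Finset.univ \ {f e.1.1, f e.1.2} : Finset (Fin N)).card := by
      have h1 := Finset.le_card_sdiff {f e.1.1, f e.1.2} (Finset.univ : Finset (Fin N))
      have h2 := Finset.card_le_two (a := f e.1.1) (b := f e.1.2)
      rw [Finset.card_univ, Fintype.card_fin] at h1
      omega
    obtain ⟨T, hT, hTp⟩ := Finset.exists_subset_card_eq hcard
    refine ⟨fun i => (T.equivFinOfCardEq hTp).symm i, ?_, ?_⟩
    · intro i j hij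
      exact (T.equivFinOfCardEq hTp).symm.injective (Subtype.ext hij)
    · intro i
      have := hT ((T.equivFinOfCardEq hTp).symm i).2
      simpa using this
  choose g hgi hgne using hg
  refine ⟨Sum.elim f (fun x => g x.1 x.2), ?_⟩
  intro e i hi j hj h
  have hne : f e.1.1 ≠ f e.1.2 := f.valid e.2.2
  rcases subdivPath_cases (p := p) e hi with rfl | rfl | ⟨a, rfl, ha⟩ <;>
  rcases subdivPath_cases (p := p) e hj with rfl | rfl | ⟨b, rfl, hb⟩
  · rfl
  · simp [hne] at h
  · rw [hb] at h; exact absurd h.symm (hgne e b).1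
  · simp [hne.symm] at h
  · rfl
  · rw [hb, subdivPath_last] at h; exact absurd h.symm (hgne e b).2
  · rw [ha] at h; exact absurd h (hgne e a).1
  · rw [ha, subdivPath_last] at h; exact absurd h (hgne e a).2
  · rw [ha, hb] at h
    have hab : a = b := hgi e h
    rw [hab]

end Path

lemma colorable_chi {n : ℕ} (G : SimpleGraph (Fin n)) : G.Colorable (chi G) :=
  Nat.sInf_mem (s := {N | G.Colorable N}) ⟨n, by simpa using G.colorable_of_fintype⟩

lemma colorable_of_exists_small_degree {V : Type*} [Finite V] (G : SimpleGraph V) (d : ℕ)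
    (h : ∀ W : Finset V, W.Nonempty → ∃ v ∈ W, {u ∈ (W : Set V) | G.Adj v u}.ncard < d) :
    G.Colorable d := by
  classical
  have := Fintype.ofFinite V
  have key : ∀ W : Finset V, ∃ c : V → ℕ, (∀ v ∈ W, c v < d) ∧
      ∀ u ∈ W, ∀ v ∈ W, G.Adj u v → c u ≠ c v := by
    intro W
    induction W using Finset.strongInduction with
    | H W ih =>
      rcases W.eq_empty_or_nonempty with rfl | hW
      · exact ⟨fun _ => 0, by simp, by simp⟩
      · obtain ⟨v, hv, hdeg⟩ := h W hW
        obtain ⟨c, hc, hproper⟩ := ih (W.erase v) (Finset.erase_ssubset hv)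
        have hdeg' : ((W.filter (G.Adj v)).image c).card < (Finset.range d).card := by
          refine Finset.card_image_le.trans_lt ?_
          rw [Finset.card_range, ← Set.ncard_coe_finset]
          simpa using hdeg
        obtain ⟨k, hk, hk'⟩ := Finset.exists_mem_notMem_of_card_lt_card hdeg'
        have hkn : ∀ u ∈ W, G.Adj v u → c u ≠ k := by
          intro u hu hvu hcu
          exact hk' (Finset.mem_image.2 ⟨u, Finset.mem_filter.2 ⟨hu, hvu⟩, hcu⟩)
        refine ⟨Function.update c v k, ?_, ?_⟩
        · intro u hu
          by_cases huv : u = v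
          · subst huv; simpa using hk
          · rw [Function.update_of_ne huv]
            exact hc u (Finset.mem_erase.2 ⟨huv, hu⟩)
        · intro x hx y hy hxy
          by_cases hxv : x = v
          · subst hxv
            rw [Function.update_self, Function.update_of_ne hxy.ne']
            exact (hkn y hy hxy).symm
          · by_cases hyv : y = v
            · subst hyv
              rw [Function.update_self, Function.update_of_ne hxv]
              exact hkn x hx hxy.symm
            · rw [Function.update_of_ne hxv, Function.update_of_ne hyv]
              exact hproper x (Finset.mem_erase.2 ⟨hxv, hx⟩) y (Finset.mem_erase.2 ⟨hyv, hy⟩) hxy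
  obtain ⟨c, hc, hproper⟩ := key Finset.univ
  exact ⟨SimpleGraph.Coloring.mk (fun v => (⟨c v, hc v (Finset.mem_univ v)⟩ : Fin d))
    fun {u v} huv heq => hproper u (Finset.mem_univ u) v (Finset.mem_univ v) huv
      (Fin.mk.inj_iff.1 heq)⟩

lemma TreeDepthLE.exists_rel {V : Type*} {G : SimpleGraph V} {S : Set V} {h : ℕ}
    (H : TreeDepthLE (G.induce S) h) : ∃ r : V → V → Prop, (∀ v ∈ S, r v v) ∧
      (∀ u v w, r u v → r v w → r u w) ∧ (∀ u v w, r u w → r v w → r u v ∨ r v u) ∧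
      (∀ u ∈ S, ∀ v ∈ S, G.Adj u v → r u v ∨ r v u) ∧ ∀ v, {u | r u v}.ncard ≤ h := by
  obtain ⟨r, ⟨hrefl, -, htrans, hchain⟩, hadj, hh⟩ := H
  refine ⟨fun u v => ∃ (hu : u ∈ S) (hv : v ∈ S), r ⟨u, hu⟩ ⟨v, hv⟩,
    fun v hv => ⟨hv, hv, hrefl _⟩, ?_, ?_, ?_, ?_⟩
  · rintro u v w ⟨hu, hv, h1⟩ ⟨_, hw, h2⟩
    exact ⟨hu, hw, htrans _ _ _ h1 h2⟩
  · rintro u v w ⟨hu, hw, h1⟩ ⟨hv, _, h2⟩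
    exact (hchain _ _ _ h1 h2).imp (fun h => ⟨hu, hv, h⟩) (fun h => ⟨hv, hu, h⟩)
  · intro u hu v hv huv
    exact (hadj ⟨u, hu⟩ ⟨v, hv⟩ huv).imp (fun h => ⟨hu, hv, h⟩) (fun h => ⟨hv, hu, h⟩)
  · intro v
    by_cases hv : v ∈ S
    · have : {u | ∃ (hu : u ∈ S) (hv : v ∈ S), r ⟨u, hu⟩ ⟨v, hv⟩}
          = Subtype.val '' {u : S | r u ⟨v, hv⟩} := by
        ext u
        simp [hv]
      rw [this, Set.ncard_image_of_injective _ Subtype.val_injective]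
      exact hh _
    · simp [hv]

section Top

variable {α : Type*} {r : α → α → Prop} {x : ℕ → α}

lemma exists_top_of_path (htrans : ∀ u v w, r u v → r v w → r u w)
    (hchain : ∀ u v w, r u w → r v w → r u v ∨ r v u) {i j : ℕ} (hij : i ≤ j)
    (hrefl : ∀ k, i ≤ k → k ≤ j → r (x k) (x k))
    (hadj : ∀ k, i ≤ k → k < j → r (x k) (x (k + 1)) ∨ r (x (k + 1)) (x k)) :
    ∃ t, i ≤ t ∧ t ≤ j ∧ ∀ k, i ≤ k → k ≤ j → r (x t) (x k) := by
  induction j, hij using Nat.le_induction with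
  | base =>
    refine ⟨i, le_rfl, le_rfl, fun k h1 h2 => ?_⟩
    obtain rfl : k = i := by omega
    exact hrefl k h1 h2
  | succ j hij ih =>
    obtain ⟨t, ht1, ht2, ht⟩ := ih (fun k h1 h2 => hrefl k h1 (by omega))
      (fun k h1 h2 => hadj k h1 (by omega))
    have htop : r (x t) (x (j + 1)) ∨ r (x (j + 1)) (x t) := by
      rcases hadj j hij (by omega) with h | h
      · exact Or.inl (htrans _ _ _ (ht j hij le_rfl) h)
      · exact hchain _ _ _ (ht j hij le_rfl) h
    rcases htop with h | h
    · refine ⟨t, ht1, by omega, fun k h1 h2 => ?_⟩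
      rcases Nat.le_succ_iff.1 h2 with h' | rfl
      · exact ht k h1 h'
      · exact h
    · refine ⟨j + 1, by omega, le_rfl, fun k h1 h2 => ?_⟩
      rcases Nat.le_succ_iff.1 h2 with h' | rfl
      · exact htrans _ _ _ h (ht k h1 h')
      · exact hrefl _ h1 le_rfl

variable {p : ℕ}

/-- If the first vertex of a path with one or two internal vertices is an ancestor of all others,
then the last vertex has a second ancestor, interior to the path. -/
lemma exists_second_ancestor (hp0 : 1 ≤ p) (hp : p ≤ 2)
    (htrans : ∀ u v w, r u v → r v w → r u w)
    (hchain : ∀ u v w, r u w → r v w → r u v ∨ r v u)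
    (hrefl : ∀ k ≤ p + 1, r (x k) (x k))
    (hadj : ∀ k ≤ p, r (x k) (x (k + 1)) ∨ r (x (k + 1)) (x k))
    (hheight : ∀ b, ∃ k ≤ p + 1, ¬ r (x k) (x b)) (h0 : ∀ k ≤ p + 1, r (x 0) (x k)) :
    ∃ t, 1 ≤ t ∧ t ≤ p ∧ r (x t) (x (p + 1)) := by
  obtain ⟨t, ht1, ht2, ht⟩ := exists_top_of_path (x := x) htrans hchain
    (by omega : 1 ≤ p + 1) (fun k _ h => hrefl k h) (fun k _ h => hadj k (by omega))
  by_cases htp : t ≤ p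
  · exact ⟨t, ht1, htp, ht _ (by omega) le_rfl⟩
  · exfalso
    obtain rfl : t = p + 1 := by omega
    have hbot : r (x 1) (x p) ∨ r (x p) (x 1) := by
      obtain rfl | rfl : p = 1 ∨ p = 2 := by omega
      · exact Or.inl (hrefl 1 (by omega))
      · exact hadj 1 (by omega)
    have hcases : ∀ k ≤ p + 1, k = 0 ∨ k = 1 ∨ k = p ∨ k = p + 1 := by omega
    rcases hbot with h | h
    · obtain ⟨k, hk, hk'⟩ := hheight p
      apply hk'
      rcases hcases k hk with rfl | rfl | rfl | rfl
      · exact h0 _ (by omega)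
      · exact h
      · exact hrefl _ hk
      · exact ht _ (by omega) (by omega)
    · obtain ⟨k, hk, hk'⟩ := hheight 1
      apply hk'
      rcases hcases k hk with rfl | rfl | rfl | rfl
      · exact h0 _ (by omega)
      · exact hrefl _ hk
      · exact h
      · exact ht _ (by omega) (by omega)

/-- On a path there is an end with a proper ancestor lying on the path. -/
lemma exists_end_ancestor
    (htrans : ∀ u v w, r u v → r v w → r u w)
    (hchain : ∀ u v w, r u w → r v w → r u v ∨ r v u)
    (hrefl : ∀ k ≤ p + 1, r (x k) (x k))
    (hadj : ∀ k ≤ p, r (x k) (x (k + 1)) ∨ r (x (k + 1)) (x k)) :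
    ∃ s t, (s = 0 ∨ s = p + 1) ∧ t ≤ p + 1 ∧ s ≠ t ∧ r (x t) (x s) := by
  obtain ⟨t, -, ht2, ht⟩ := exists_top_of_path (x := x) htrans hchain
    (by omega : 0 ≤ p + 1) (fun k _ h => hrefl k h) (fun k _ h => hadj k (by omega))
  by_cases h : t = 0
  · exact ⟨p + 1, t, Or.inr rfl, ht2, by omega, ht _ (by omega) le_rfl⟩
  · exact ⟨0, t, Or.inl rfl, ht2, fun h' => h h'.symm, ht _ le_rfl (by omega)⟩

/-- On a path with one or two internal vertices, whose vertices do not form a chain, there are two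
pairs consisting of an end and of a proper ancestor of it on the path. -/
lemma exists_two_end_ancestors (hp0 : 1 ≤ p) (hp : p ≤ 2)
    (htrans : ∀ u v w, r u v → r v w → r u w)
    (hchain : ∀ u v w, r u w → r v w → r u v ∨ r v u)
    (hrefl : ∀ k ≤ p + 1, r (x k) (x k))
    (hadj : ∀ k ≤ p, r (x k) (x (k + 1)) ∨ r (x (k + 1)) (x k))
    (hheight : ∀ b, ∃ k ≤ p + 1, ¬ r (x k) (x b)) :
    ∃ s t s' t', (s, t) ≠ (s', t') ∧
      ((s = 0 ∨ s = p + 1) ∧ t ≤ p + 1 ∧ s ≠ t ∧ r (x t) (x s)) ∧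
      ((s' = 0 ∨ s' = p + 1) ∧ t' ≤ p + 1 ∧ s' ≠ t' ∧ r (x t') (x s')) := by
  obtain ⟨t, -, ht2, ht⟩ := exists_top_of_path (x := x) htrans hchain
    (by omega : 0 ≤ p + 1) (fun k _ h => hrefl k h) (fun k _ h => hadj k (by omega))
  rcases (by omega : t = 0 ∨ t = p + 1 ∨ (1 ≤ t ∧ t ≤ p)) with rfl | rfl | ⟨h1, h2⟩
  · obtain ⟨t', h1, h2, h3⟩ := exists_second_ancestor hp0 hp htrans hchain hrefl hadj hheight
      (fun k hk => ht k (by omega) hk)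
    refine ⟨p + 1, 0, p + 1, t', ?_, ⟨Or.inr rfl, by omega, by omega, ht _ (by omega) le_rfl⟩,
      ⟨Or.inr rfl, by omega, by omega, h3⟩⟩
    simp only [ne_eq, Prod.mk.injEq, true_and]
    omega
  · obtain ⟨t', h1, h2, h3⟩ := exists_second_ancestor (x := fun k => x (p + 1 - k)) hp0 hp htrans
      hchain (fun k hk => hrefl _ (by omega))
      (fun k hk => by
        have := hadj (p - k) (by omega)
        rw [show p - k + 1 = p + 1 - k by omega] at this
        rw [show p + 1 - (k + 1) = p - k by omega]
        exact this.symm)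
      (fun b => by
        obtain ⟨k, hk, h⟩ := hheight (p + 1 - b)
        exact ⟨p + 1 - k, by omega, by rwa [show p + 1 - (p + 1 - k) = k by omega]⟩)
      (fun k hk => ht _ (by omega) (by omega))
    simp only [Nat.sub_self] at h3
    refine ⟨0, p + 1, 0, p + 1 - t', ?_, ⟨Or.inl rfl, by omega, by omega, ht _ le_rfl (by omega)⟩,
      ⟨Or.inl rfl, by omega, by omega, h3⟩⟩
    simp only [ne_eq, Prod.mk.injEq, true_and]
    omega
  · refine ⟨0, t, p + 1, t, ?_, ⟨Or.inl rfl, by omega, by omega, ht _ le_rfl (by omega)⟩,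
      ⟨Or.inr rfl, by omega, by omega, ht _ (by omega) le_rfl⟩⟩
    simp only [ne_eq, Prod.mk.injEq]
    omega

end Top

section Counting

variable {n : ℕ} {G : SimpleGraph (Fin n)} {p : ℕ}

/-- The edge of `G` determined by a vertex of `G` and another vertex on a subdivided edge at it. -/
def edgeOfPair : Fin n × (Fin n ⊕ Σ _ : Edges G, Fin p) → Fin n × Fin n
  | (w, Sum.inl u) => (min w u, max w u)
  | (_, Sum.inr ⟨e, _⟩) => e.1

lemma exists_end_subdivPath (e : Edges G) {s : ℕ} (hs : s = 0 ∨ s = p + 1) :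
    ∃ w, (w = e.1.1 ∨ w = e.1.2) ∧
      (subdivPath e s : Fin n ⊕ Σ _ : Edges G, Fin p) = Sum.inl w := by
  rcases hs with rfl | rfl
  · exact ⟨e.1.1, Or.inl rfl, rfl⟩
  · exact ⟨e.1.2, Or.inr rfl, subdivPath_last e⟩

lemma edgeOfPair_subdivPath (e : Edges G) {s t : ℕ} (hs : s = 0 ∨ s = p + 1) (ht : t ≤ p + 1)
    (hst : s ≠ t) {w : Fin n}
    (hw : (subdivPath e s : Fin n ⊕ Σ _ : Edges G, Fin p) = Sum.inl w) :
    edgeOfPair (w, (subdivPath e t : Fin n ⊕ Σ _ : Edges G, Fin p)) = e.1 := by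
  have hlt : e.1.1 < e.1.2 := e.2.1
  rcases subdivPath_cases (p := p) e ht with rfl | rfl | ⟨b, rfl, hb⟩
  · obtain rfl : s = p + 1 := by omega
    rw [subdivPath_last, Sum.inl.injEq] at hw
    subst hw
    simp [edgeOfPair, hlt.le]
  · obtain rfl : s = 0 := by omega
    rw [subdivPath_zero, Sum.inl.injEq] at hw
    subst hw
    simp [edgeOfPair, hlt.le]
  · rw [hb]
    rfl

lemma mul_card_edges_le {N h k : ℕ} (c : (Fin n ⊕ Σ _ : Edges G, Fin p) → Fin N)
    (hc : ∀ I : Finset (Fin N), I.card ≤ p + 1 →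
      TreeDepthLE ((Subdiv G (fun _ => p)).induce {v | c v ∈ I}) I.card)
    (hk : k ≤ 1 ∨ k ≤ 2 ∧ 1 ≤ p ∧ p ≤ 2) (hh : h ≤ p) (a : Fin N)
    (F : Finset (Finset (Fin N))) (hF : ∀ I ∈ F, a ∈ I ∧ I.card ≤ h + 1)
    (hcover : ∀ T : Finset (Fin N), a ∈ T → T.card ≤ p + 1 → ∃ I ∈ F, T ⊆ I)
    (W : Finset (Fin n)) (hW : ∀ w ∈ W, c (Sum.inl w) = a)
    (E : Finset (Fin n × Fin n))
    (hE : ∀ e ∈ E, (e.1 < e.2 ∧ G.Adj e.1 e.2) ∧ e.1 ∈ W ∧ e.2 ∈ W) :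
    k * E.card ≤ W.card * (F.card * h) := by
  classical
  have := Fintype.ofFinite (Fin n ⊕ Σ _ : Edges G, Fin p)
  choose! R hrefl htrans hchain hadj hheight using
    fun (I : Finset (Fin N)) (hI : I.card ≤ p + 1) => (hc I hI).exists_rel
  have hFp : ∀ I ∈ F, I.card ≤ p + 1 := fun I hI => (hF I hI).2.trans (by omega)
  let Q : Finset (Fin n × (Fin n ⊕ Σ _ : Edges G, Fin p)) := W.biUnion fun w => F.biUnion fun I =>
    ((Finset.univ.filter fun z => R I z (Sum.inl w)).erase (Sum.inl w)).image fun z => (w, z)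
  have hQmem : ∀ w ∈ W, ∀ I ∈ F, ∀ z, z ≠ Sum.inl w → R I z (Sum.inl w) → (w, z) ∈ Q := by
    intro w hw I hI z hz hR
    simp only [Q, Finset.mem_biUnion, Finset.mem_image, Finset.mem_erase, Finset.mem_filter,
      Finset.mem_univ, true_and]
    exact ⟨w, hw, I, hI, z, ⟨hz, hR⟩, rfl⟩
  have hQcard : Q.card ≤ W.card * (F.card * h) := by
    refine Finset.card_biUnion_le_card_mul _ _ _ fun w hw => ?_
    refine Finset.card_biUnion_le_card_mul _ _ _ fun I hI => ?_
    refine Finset.card_image_le.trans ?_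
    have hwI : c (Sum.inl w) ∈ I := hW w hw ▸ (hF I hI).1
    have hwR : Sum.inl w ∈ Finset.univ.filter fun z => R I z (Sum.inl w) :=
      Finset.mem_filter.2 ⟨Finset.mem_univ _, hrefl I (hFp I hI) _ hwI⟩
    rw [Finset.card_erase_of_mem hwR]
    have h1 := hheight I (hFp I hI) (Sum.inl w)
    rw [← Finset.coe_filter_univ, Set.ncard_coe_finset] at h1
    have h2 := (hF I hI).2
    omega
  refine le_trans ?_ hQcard
  have hfiber : ∀ e ∈ E, k ≤ (Q.filter fun q => edgeOfPair q = e).card := by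
    intro e he
    obtain ⟨he, heW1, heW2⟩ := hE e he
    obtain ⟨e, rfl⟩ : ∃ e' : Edges G, e'.1 = e := ⟨⟨e, he⟩, rfl⟩
    have hends : c (subdivPath e 0) = a ∧ c (subdivPath e (p + 1)) = a :=
      ⟨hW _ heW1, by rw [subdivPath_last]; exact hW _ heW2⟩
    obtain ⟨I, hI, hTI⟩ := hcover ((Finset.range (p + 1)).image fun i => c (subdivPath e i))
      (Finset.mem_image.2 ⟨0, by simp, hends.1⟩) (Finset.card_image_le.trans (by simp))
    have hmem : ∀ i ≤ p + 1, c (subdivPath e i) ∈ I := by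
      intro i hi
      rcases Nat.le_succ_iff.1 hi with h' | rfl
      · exact hTI (Finset.mem_image.2 ⟨i, Finset.mem_range.2 (by omega), rfl⟩)
      · rw [hends.2]; exact (hF I hI).1
    have hIp := hFp I hI
    have hrefl' : ∀ k ≤ p + 1, R I (subdivPath e k) (subdivPath e k) :=
      fun k hk => hrefl I hIp _ (hmem k hk)
    have hadj' : ∀ k ≤ p, R I (subdivPath e k) (subdivPath e (k + 1)) ∨
        R I (subdivPath e (k + 1)) (subdivPath e k) :=
      fun k hk => hadj I hIp _ (hmem k (by omega)) _ (hmem _ (by omega)) (subdivPath_adj e hk)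
    have hheight' : ∀ b, ∃ k ≤ p + 1, ¬ R I (subdivPath e k) (subdivPath e b) := by
      intro b
      by_contra! hb
      have h1 : (Finset.range (p + 2)).card ≤
          (Finset.univ.filter fun u => R I u (subdivPath e b)).card := by
        refine Finset.card_le_card_of_injOn (subdivPath e) ?_ ?_
        · intro k hk
          simp only [Finset.coe_range, Set.mem_Iio] at hk
          simpa using hb k (by omega)
        · intro i hi j hj hij
          simp only [Finset.coe_range, Set.mem_Iio] at hi hj
          exact subdivPath_injOn e (by omega) (by omega) hij
      have h2 := hheight I hIp (subdivPath e b)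
      rw [← Finset.coe_filter_univ, Set.ncard_coe_finset] at h2
      simp only [Finset.card_range] at h1
      omega
    have hpair : ∀ s t, ((s = 0 ∨ s = p + 1) ∧ t ≤ p + 1 ∧ s ≠ t ∧
        R I (subdivPath e t) (subdivPath e s)) → ∃ w,
        (subdivPath e s : Fin n ⊕ Σ _ : Edges G, Fin p) = Sum.inl w ∧
        (w, subdivPath e t) ∈ Q.filter fun q => edgeOfPair q = e.1 := by
      rintro s t ⟨hs, ht, hst, hR⟩
      obtain ⟨w, hw, hsw⟩ := exists_end_subdivPath (p := p) e hs
      refine ⟨w, hsw, Finset.mem_filter.2 ⟨hQmem w ?_ I hI _ ?_ ?_,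
        edgeOfPair_subdivPath e hs ht hst hsw⟩⟩
      · rcases hw with rfl | rfl
        · exact heW1
        · exact heW2
      · rw [← hsw]
        intro heq
        exact hst (subdivPath_injOn e (by omega) ht heq.symm)
      · rwa [← hsw]
    rcases hk with hk | ⟨hk, hp1, hp2⟩
    · obtain ⟨s, t, hst⟩ := exists_end_ancestor (htrans I hIp) (hchain I hIp) hrefl' hadj'
      obtain ⟨w, -, hw⟩ := hpair s t hst
      exact hk.trans (Finset.card_pos.2 ⟨_, hw⟩)
    · obtain ⟨s, t, s', t', hne, hst, hst'⟩ := exists_two_end_ancestors hp1 hp2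
        (htrans I hIp) (hchain I hIp) hrefl' hadj' hheight'
      obtain ⟨w, hw, hwQ⟩ := hpair s t hst
      obtain ⟨w', hw', hwQ'⟩ := hpair s' t' hst'
      refine hk.trans (Finset.one_lt_card.2 ⟨_, hwQ, _, hwQ', ?_⟩)
      intro heq
      rw [Prod.mk.injEq] at heq
      obtain ⟨rfl, htt⟩ := heq
      apply hne
      rw [Prod.mk.injEq]
      have h1 := hst.1
      have h1' := hst'.1
      exact ⟨subdivPath_injOn e (by omega) (by omega) (hw.trans hw'.symm),
        subdivPath_injOn e hst.2.1 hst'.2.1 htt⟩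
  calc k * E.card = ∑ _e ∈ E, k := by rw [Finset.sum_const, smul_eq_mul, mul_comm]
    _ ≤ ∑ e ∈ E, (Q.filter fun q => edgeOfPair q = e).card := Finset.sum_le_sum hfiber
    _ = (E.biUnion fun e => Q.filter fun q => edgeOfPair q = e).card := by
        rw [Finset.card_biUnion]
        intro e _ e' _ hne
        rw [Function.onFun, Finset.disjoint_left]
        intro q hq hq'
        exact hne ((Finset.mem_filter.1 hq).2.symm.trans (Finset.mem_filter.1 hq').2)
    _ ≤ Q.card := Finset.card_le_card fun q hq => by
        obtain ⟨e, _, hq⟩ := Finset.mem_biUnion.1 hq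
        exact (Finset.mem_filter.1 hq).1

/-- A family of colour sets as in `mul_card_edges_le`, small enough for the final count. -/
lemma exists_family {N : ℕ} (p : ℕ) (a : Fin N) :
    ∃ (h k : ℕ) (F : Finset (Finset (Fin N))), (k ≤ 1 ∨ k ≤ 2 ∧ 1 ≤ p ∧ p ≤ 2) ∧ h ≤ p ∧
      (∀ I ∈ F, a ∈ I ∧ I.card ≤ h + 1) ∧
      (∀ T : Finset (Fin N), a ∈ T → T.card ≤ p + 1 → ∃ I ∈ F, T ⊆ I) ∧
      2 * (F.card * h) < k * N ^ p := by
  classical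
  have hN : 0 < N := a.pos
  by_cases hNp : N ≤ p
  · refine ⟨N - 1, 1, {Finset.univ}, Or.inl le_rfl, by omega, ?_, ?_, ?_⟩
    · intro I hI
      rw [Finset.mem_singleton.1 hI]
      simp only [Finset.mem_univ, Finset.card_univ, Fintype.card_fin, true_and]
      omega
    · exact fun T _ _ => ⟨Finset.univ, Finset.mem_singleton_self _, Finset.subset_univ _⟩
    · obtain ⟨m, rfl⟩ : ∃ m, N = m + 1 := ⟨N - 1, by omega⟩
      simp only [Finset.card_singleton, Nat.add_sub_cancel, one_mul]
      rcases Nat.eq_zero_or_pos m with rfl | hm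
      · simp
      · calc 2 * m < (m + 1) ^ 2 := by nlinarith
          _ ≤ (m + 1) ^ p := Nat.pow_le_pow_right (by omega) (by omega)
  · obtain ⟨k, hk, hk2⟩ : ∃ k, (k ≤ 1 ∨ k ≤ 2 ∧ 1 ≤ p ∧ p ≤ 2) ∧ 2 * p ≤ k * p.factorial ∧ 1 ≤ k := by
      rcases (by omega : p = 0 ∨ p = 1 ∨ p = 2 ∨ 3 ≤ p) with rfl | rfl | rfl | hp
      · exact ⟨1, by simp⟩
      · exact ⟨2, by simp⟩
      · exact ⟨2, by simp [Nat.factorial]⟩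
      · refine ⟨1, Or.inl le_rfl, ?_, le_rfl⟩
        obtain ⟨q, rfl⟩ : ∃ q, p = q + 1 := ⟨p - 1, by omega⟩
        have h2 : 2 ≤ q.factorial := (by omega : 2 ≤ q).trans (Nat.self_le_factorial q)
        rw [Nat.factorial_succ, one_mul, mul_comm 2]
        exact Nat.mul_le_mul_left _ h2
    refine ⟨p, k, ((Finset.univ.erase a).powersetCard p).image (insert a), hk, le_rfl, ?_, ?_, ?_⟩
    · intro I hI
      obtain ⟨J, hJ, rfl⟩ := Finset.mem_image.1 hI
      refine ⟨Finset.mem_insert_self _ _, (Finset.card_insert_le _ _).trans ?_⟩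
      rw [(Finset.mem_powersetCard.1 hJ).2]
    · intro T haT hT
      have h1 : (T.erase a).card ≤ p := by
        rw [Finset.card_erase_of_mem haT]; omega
      have h2 : p ≤ (Finset.univ.erase a).card := by
        rw [Finset.card_erase_of_mem (Finset.mem_univ a), Finset.card_univ, Fintype.card_fin]
        omega
      obtain ⟨J, hTJ, hJ, hJp⟩ := Finset.exists_subsuperset_card_eq
        (Finset.erase_subset_erase a (Finset.subset_univ T)) h1 h2
      refine ⟨insert a J, Finset.mem_image_of_mem _ (Finset.mem_powersetCard.2 ⟨hJ, hJp⟩), ?_⟩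
      rw [← Finset.insert_erase haT]
      exact Finset.insert_subset_insert a hTJ
    · have hcard : (((Finset.univ.erase a).powersetCard p).image (insert a)).card
          ≤ (N - 1).choose p := by
        refine Finset.card_image_le.trans ?_
        rw [Finset.card_powersetCard, Finset.card_erase_of_mem (Finset.mem_univ a),
          Finset.card_univ, Fintype.card_fin]
      have hfac : p.factorial * (N - 1).choose p ≤ (N - 1) ^ p := by
        rw [← Nat.descFactorial_eq_factorial_mul_choose]
        exact Nat.descFactorial_le_pow _ _
      rcases Nat.eq_zero_or_pos p with rfl | hp
      · simpa using Nat.pos_of_ne_zero (by omega : k ≠ 0)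
      · have hlt : (N - 1) ^ p < N ^ p := Nat.pow_lt_pow_left (by omega) (by omega)
        generalize (((Finset.univ.erase a).powersetCard p).image (insert a)).card = f at *
        calc 2 * (f * p) = (2 * p) * f := by ring
          _ ≤ (k * p.factorial) * (N - 1).choose p := Nat.mul_le_mul hk2.1 hcard
          _ = k * (p.factorial * (N - 1).choose p) := by ring
          _ ≤ k * (N - 1) ^ p := Nat.mul_le_mul_left _ hfac
          _ < k * N ^ p := Nat.mul_lt_mul_of_pos_left hlt hk2.2

lemma sum_card_filter_adj_le (W : Finset (Fin n)) [DecidableRel G.Adj] :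
    ∑ v ∈ W, (W.filter (G.Adj v)).card ≤
      2 * ((W ×ˢ W).filter fun e => e.1 < e.2 ∧ G.Adj e.1 e.2).card := by
  set E := (W ×ˢ W).filter fun e => e.1 < e.2 ∧ G.Adj e.1 e.2 with hE
  calc ∑ v ∈ W, (W.filter (G.Adj v)).card = (W.sigma fun v => W.filter (G.Adj v)).card :=
        (Finset.card_sigma _ _).symm
    _ = ((W.sigma fun v => W.filter (G.Adj v)).image fun x => (x.1, x.2)).card := by
        rw [Finset.card_image_of_injective]
        rintro ⟨x, y⟩ ⟨x', y'⟩ h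
        simpa using h
    _ ≤ (E ∪ E.image Prod.swap).card := by
        apply Finset.card_le_card
        intro e he
        simp only [Finset.mem_image, Finset.mem_sigma, Finset.mem_filter] at he
        obtain ⟨⟨u, v⟩, ⟨hu, hv, huv⟩, rfl⟩ := he
        simp only [hE, Finset.mem_union, Finset.mem_image, Finset.mem_filter, Finset.mem_product]
        rcases lt_or_gt_of_ne huv.ne with h | h
        · exact Or.inl ⟨⟨hu, hv⟩, h, huv⟩
        · exact Or.inr ⟨(v, u), ⟨⟨hv, hu⟩, h, huv.symm⟩, rfl⟩
    _ ≤ E.card + (E.image Prod.swap).card := Finset.card_union_le _ _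
    _ ≤ E.card + E.card := Nat.add_le_add_left Finset.card_image_le _
    _ = 2 * E.card := (two_mul _).symm

lemma exists_small_degree {N : ℕ} (c : (Fin n ⊕ Σ _ : Edges G, Fin p) → Fin N)
    (hc : ∀ I : Finset (Fin N), I.card ≤ p + 1 →
      TreeDepthLE ((Subdiv G (fun _ => p)).induce {v | c v ∈ I}) I.card)
    (a : Fin N) (W : Finset (Fin n)) (hW0 : W.Nonempty) (hW : ∀ w ∈ W, c (Sum.inl w) = a)
    [DecidableRel G.Adj] : ∃ v ∈ W, (W.filter (G.Adj v)).card < N ^ p := by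
  by_contra! hdeg
  obtain ⟨h, k, F, hk, hh, hF, hcover, hlt⟩ := exists_family p a
  have h1 := mul_card_edges_le c hc hk hh a F hF hcover W hW
    ((W ×ˢ W).filter fun e => e.1 < e.2 ∧ G.Adj e.1 e.2) (fun e he => by
      rw [Finset.mem_filter, Finset.mem_product] at he
      exact ⟨he.2, he.1⟩)
  have h2 := sum_card_filter_adj_le (G := G) W
  have h3 : W.card * N ^ p ≤ ∑ v ∈ W, (W.filter (G.Adj v)).card := by
    simpa using Finset.card_nsmul_le_sum W _ _ hdeg
  have h4 : k * (W.card * N ^ p) ≤ W.card * (2 * (F.card * h)) := by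
    refine (Nat.mul_le_mul_left k (h3.trans h2)).trans ?_
    linarith
  have h5 : W.card * (2 * (F.card * h)) < W.card * (k * N ^ p) :=
    Nat.mul_lt_mul_of_pos_left hlt (Finset.card_pos.2 hW0)
  linarith

lemma colorable_of_subdiv_coloring {N : ℕ} (c : (Fin n ⊕ Σ _ : Edges G, Fin p) → Fin N)
    (hc : ∀ I : Finset (Fin N), I.card ≤ p + 1 →
      TreeDepthLE ((Subdiv G (fun _ => p)).induce {v | c v ∈ I}) I.card) :
    G.Colorable (N ^ (p + 1)) := by
  classical
  let G' : SimpleGraph (Fin n) :=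
    { Adj := fun u v => G.Adj u v ∧ c (Sum.inl u) = c (Sum.inl v)
      symm := ⟨fun _ _ h => ⟨h.1.symm, h.2.symm⟩⟩
      loopless := ⟨fun _ h => h.1.ne rfl⟩ }
  have hG' : G'.Colorable (N ^ p) := by
    refine colorable_of_exists_small_degree G' _ fun W hW => ?_
    obtain ⟨w, hw⟩ := hW
    obtain ⟨v, hv, hdeg⟩ := exists_small_degree c hc (c (Sum.inl w))
      (W.filter fun v => c (Sum.inl v) = c (Sum.inl w)) ⟨w, Finset.mem_filter.2 ⟨hw, rfl⟩⟩
      (fun v hv => (Finset.mem_filter.1 hv).2)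
    obtain ⟨hvW, hva⟩ := Finset.mem_filter.1 hv
    refine ⟨v, hvW, lt_of_le_of_lt ?_ hdeg⟩
    rw [← Set.ncard_coe_finset]
    refine Set.ncard_le_ncard ?_ (Finset.finite_toSet _)
    rintro u ⟨hu, huv⟩
    simp only [Finset.coe_filter, Finset.mem_filter, Set.mem_ofPred_eq]
    exact ⟨⟨hu, huv.2.symm.trans hva⟩, huv.1⟩
  obtain ⟨f⟩ := hG'
  have hcol : G.Coloring (Fin N × Fin (N ^ p)) :=
    SimpleGraph.Coloring.mk (fun v => (c (Sum.inl v), f v)) fun {u v} huv heq => by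
      rw [Prod.mk.injEq] at heq
      exact f.valid (show G'.Adj u v from ⟨huv, heq.1⟩) heq.2
  have := hcol.colorable
  rwa [Fintype.card_prod, Fintype.card_fin, Fintype.card_fin, ← pow_succ'] at this

end Counting

/-- For every `p ≥ 0` and every graph `G`,
`χ(G)^{1/(p+1)} ≤ χ_{p+1}(G^{(p)}) ≤ max(χ(G), p+2)`, stated as
`χ(G) ≤ χ_{p+1}(G^{(p)})^{p+1}` and `χ_{p+1}(G^{(p)}) ≤ max(χ(G), p+2)`. -/
theorem chiP_subdivision_bounds (p : ℕ) (n : ℕ) (G : SimpleGraph (Fin n)) :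
    chi G ≤ chiP (Subdiv G (fun _ => p)) (p + 1) ^ (p + 1) ∧
    chiP (Subdiv G (fun _ => p)) (p + 1) ≤ max (chi G) (p + 2) := by
  obtain ⟨f⟩ : G.Colorable (max (chi G) (p + 2)) := (colorable_chi G).mono (le_max_left _ _)
  obtain ⟨c, hc⟩ := exists_subdiv_coloring (p := p) (le_max_right _ _) f
  have hmem : max (chi G) (p + 2) ∈ {N | ∃ c : (Fin n ⊕ Σ _ : Edges G, Fin p) → Fin N,
      ∀ I : Finset (Fin N), I.card ≤ p + 1 →
        TreeDepthLE ((Subdiv G (fun _ => p)).induce {v | c v ∈ I}) I.card} :=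
    ⟨c, treeDepthLE_induce_subdiv c hc⟩
  refine ⟨?_, Nat.sInf_le hmem⟩
  obtain ⟨c', hc'⟩ := Nat.sInf_mem ⟨_, hmem⟩
  exact Nat.sInf_le (colorable_of_subdiv_coloring c' hc')
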